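/- Let (R, m) be a Noetherian local ring of prime characteristic p > 0 and A an Artinian R-module equipped with a Frobenius action F : A → A (an additive map with F(ra) = r^p F(a)). Then there exists a non-negative integer e such that 0^F_A = ker(F^e : A → A), where 0^F_A = {z ∈ A | F^n(z) = 0 for some n ≥ 0}; equivalently, the increasing chain ker F ⊆ ker F^2 ⊆ … stabilizes. -/

import Mathlib

open Ideal

/-- The `q`-th Frobenius power of an ideal: the ideal generated by `q`-th powers of its elements. -/
def frobPow {R : Type*} [CommRing R] (I : Ideal R) (q : ℕ) : Ideal R :=
  Ideal.span ((· ^ q) '' (I : Set R))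

/-- The Frobenius closure of an ideal, as a set. -/
def frobClosure {R : Type*} [CommRing R] (I : Ideal R) (p : ℕ) : Set R :=
  {x | ∃ e : ℕ, x ^ p ^ e ∈ frobPow I (p ^ e)}

universe u

/-- A finite module killed by an ideal with Artinian quotient is Artinian. -/
theorem HSL.fl {S : Type*} [CommRing S] (I : Ideal S) [IsArtinianRing (S ⧸ I)]
    (X : Type*) [AddCommGroup X] [Module S X] [Module.Finite S X]
    (h : ∀ s ∈ I, ∀ x : X, s • x = 0) : IsArtinian S X := by
  have hA : IsArtinian S (S ⧸ I) :=
    isArtinian_of_surjective_algebraMap (R := S ⧸ I) Ideal.Quotient.mk_surjective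
  obtain ⟨n, f, hf⟩ := Module.Finite.exists_fin' S X
  let g : (Fin n → S ⧸ I) →ₗ[S] X :=
    ∑ i, (Submodule.liftQ I (LinearMap.toSpanSingleton S X (f (fun j => if i = j then 1 else 0)))
      (fun s hs => by simpa using h s hs _)) ∘ₗ LinearMap.proj i
  have hg : Function.Surjective g := by
    intro x
    obtain ⟨v, rfl⟩ := hf x
    refine ⟨fun i => Ideal.Quotient.mk I (v i), ?_⟩
    have := LinearMap.pi_apply_eq_sum_univ f v
    rw [this]
    simp only [g, LinearMap.sum_apply, LinearMap.comp_apply, LinearMap.proj_apply]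
    rfl
  exact isArtinian_of_surjective _ g hg

theorem HSL.exists_inj (R : Type u) [CommRing R] [IsLocalRing R] :
    ∃ (Q : ModuleCat.{u} R) (x : Q), Module.Baer R Q ∧ x ≠ 0 ∧
      ∀ r ∈ IsLocalRing.maximalIdeal R, r • x = 0 := by
  let k := ModuleCat.of R (IsLocalRing.ResidueField R)
  obtain ⟨⟨Q, hQ, f, hf⟩⟩ := CategoryTheory.EnoughInjectives.presentation k
  have hinj := (ModuleCat.mono_iff_injective f).1 hf
  have hQ' := Module.injective_module_of_injective_object R Q
  refine ⟨Q, f.hom (1 : IsLocalRing.ResidueField R), Module.Baer.of_injective hQ', ?_, ?_⟩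
  · intro h
    have : f.hom (1 : IsLocalRing.ResidueField R) = f.hom (0 : IsLocalRing.ResidueField R) := by
      rw [h]; exact (map_zero f.hom).symm
    exact one_ne_zero (α := IsLocalRing.ResidueField R) (hinj this)
  · intro r hr
    have h0 : r • (1 : IsLocalRing.ResidueField R) = 0 := by
      rw [Algebra.smul_def, mul_one]
      exact (IsLocalRing.residue_eq_zero_iff r).2 hr
    have := f.hom.map_smul r (1 : IsLocalRing.ResidueField R)
    refine this.symm.trans ?_
    exact (congrArg f.hom h0).trans (map_zero f.hom)

/-- The injective hull of the residue field. -/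
theorem HSL.exists_hull (R : Type u) [CommRing R] [IsLocalRing R] :
    ∃ (E : ModuleCat.{u} R) (x₀ : E), Module.Baer R E ∧ x₀ ≠ 0 ∧
      (∀ r ∈ IsLocalRing.maximalIdeal R, r • x₀ = 0) ∧ ∀ x : E, x ≠ 0 → ∃ r : R, r • x = x₀ := by
  obtain ⟨Q, x₀, hQ, hx₀, hm⟩ := HSL.exists_inj R
  -- maximal essential extension
  have hunit : ∀ x : Q, ∀ r : R, x ≠ 0 → r • x₀ = x → ∃ s : R, s • x = x₀ := by
    rintro x r hx rfl
    have : IsUnit r := by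
      by_contra hr
      exact hx (hm r ((IsLocalRing.mem_maximalIdeal r).2 hr))
    obtain ⟨u, rfl⟩ := this
    exact ⟨((u⁻¹ : Rˣ) : R), by rw [smul_smul]; simp⟩
  let P : Set (Submodule R Q) := {E | ∀ x ∈ E, x ≠ 0 → ∃ r : R, r • x = x₀}
  have hS : Submodule.span R {x₀} ∈ P := by
    intro x hx hx0
    obtain ⟨r, hr⟩ := Submodule.mem_span_singleton.1 hx
    exact hunit x r hx0 hr
  obtain ⟨E, hSE, hE⟩ := zorn_le_nonempty₀ P (by
    intro c hcP hc y hy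
    refine ⟨sSup c, ?_, fun z hz => le_sSup hz⟩
    intro x hx hx0
    obtain ⟨z, hz, hxz⟩ := (Submodule.mem_sSup_of_directed ⟨y, hy⟩ hc.directedOn).1 hx
    exact hcP hz x hxz hx0) _ hS
  have hx₀E : x₀ ∈ E := hSE (Submodule.mem_span_singleton_self x₀)
  -- maximal complement
  let P' : Set (Submodule R Q) := {C | x₀ ∉ C}
  obtain ⟨C, -, hC⟩ := zorn_le_nonempty₀ P' (by
    intro c hcP hc y hy
    refine ⟨sSup c, ?_, fun z hz => le_sSup hz⟩
    intro hx
    obtain ⟨z, hz, hxz⟩ := (Submodule.mem_sSup_of_directed ⟨y, hy⟩ hc.directedOn).1 hx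
    exact hcP hz hxz) ⊥ (by simpa [P'] using hx₀)
  -- Q / C is essential over the image of x₀
  have hess : ∀ q : Q, q ∉ C → ∃ r : R, r • q - x₀ ∈ C := by
    intro q hq
    have : x₀ ∈ C ⊔ Submodule.span R {q} := by
      by_contra h
      have := hC.2 (y := C ⊔ Submodule.span R {q}) h le_sup_left
      exact hq (this (Submodule.mem_sup_right (Submodule.mem_span_singleton_self q)))
    obtain ⟨c, hc, d, hd, hcd⟩ := Submodule.mem_sup.1 this
    obtain ⟨r, rfl⟩ := Submodule.mem_span_singleton.1 hd
    refine ⟨r, ?_⟩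
    rw [← hcd]
    simpa using hc
  have hinj : Function.Injective (C.mkQ ∘ₗ E.subtype) := by
    rw [injective_iff_map_eq_zero]
    intro x hx
    by_contra hne
    obtain ⟨r, hr⟩ := hE.1 x.1 x.2 (by simpa using hne)
    have hxC : (x : Q) ∈ C := by simpa using hx
    exact hC.1 (hr ▸ C.smul_mem r hxC)
  obtain ⟨ψ, hψ⟩ := hQ.extension_property _ hinj E.subtype
  have hψ' : ∀ x ∈ E, ψ (C.mkQ x) = x := fun x hx => LinearMap.congr_fun hψ ⟨x, hx⟩
  have hrange : LinearMap.range ψ ∈ P := by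
    rintro _ ⟨y, rfl⟩ hy
    obtain ⟨q, rfl⟩ := C.mkQ_surjective y
    have hq : q ∉ C := by
      intro h; apply hy
      rw [(by simpa using h : C.mkQ q = 0), map_zero]
    obtain ⟨r, hr⟩ := hess q hq
    refine ⟨r, ?_⟩
    rw [← map_smul, ← hψ' x₀ hx₀E]
    congr 1
    rw [← map_smul, ← sub_eq_zero, ← map_sub]
    exact (Submodule.Quotient.mk_eq_zero C).2 hr
  have hER : E ≤ LinearMap.range ψ := fun x hx => ⟨_, hψ' x hx⟩
  have hRE : LinearMap.range ψ ≤ E := hE.2 hrange hER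
  let ρ : Q →ₗ[R] E := LinearMap.codRestrict E (ψ ∘ₗ C.mkQ) (fun q => hRE ⟨_, rfl⟩)
  have hρ : ∀ x : E, ρ x = x := fun x => Subtype.ext (hψ' x.1 x.2)
  refine ⟨ModuleCat.of R E, ⟨x₀, hx₀E⟩, ?_, ?_, ?_, ?_⟩
  · intro I g
    obtain ⟨g', hg'⟩ := hQ I (E.subtype ∘ₗ g)
    refine ⟨ρ ∘ₗ g', fun x hx => ?_⟩
    have := hg' x hx
    simp only [LinearMap.comp_apply] at this ⊢
    rw [this]
    exact hρ _
  · intro h; exact hx₀ (congrArg Subtype.val h)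
  · intro r hr; exact Subtype.ext (hm r hr)
  · intro x hx
    obtain ⟨r, hr⟩ := hE.1 x.1 x.2 (fun h => hx (Subtype.ext h))
    exact ⟨r, Subtype.ext hr⟩


section
variable {R : Type*} [CommRing R] [IsLocalRing R] {E : Type*} [AddCommGroup E] [Module R E]
  {x₀ : E}

theorem HSL.cogen (hB : Module.Baer R E) (hx : x₀ ≠ 0)
    (hm : ∀ r ∈ IsLocalRing.maximalIdeal R, r • x₀ = 0)
    {M : Type*} [AddCommGroup M] [Module R M] (a : M) (ha : a ≠ 0) :
    ∃ f : M →ₗ[R] E, f a ≠ 0 := by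
  let t := LinearMap.toSpanSingleton R M a
  let i : (R ⧸ LinearMap.ker t) →ₗ[R] M := (LinearMap.ker t).liftQ t le_rfl
  have hi : Function.Injective i := by
    rw [← LinearMap.ker_eq_bot]
    exact Submodule.ker_liftQ_eq_bot _ _ _ le_rfl
  let g : (R ⧸ LinearMap.ker t) →ₗ[R] E :=
    (LinearMap.ker t).liftQ (LinearMap.toSpanSingleton R E x₀) (by
      intro r hr
      have hr' : r • a = 0 := by simpa [t] using hr
      have : r ∈ IsLocalRing.maximalIdeal R := by
        rw [IsLocalRing.mem_maximalIdeal]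
        intro hu
        exact ha ((hu.smul_eq_zero).1 hr')
      simpa using hm r this)
  obtain ⟨f, hf⟩ := hB.extension_property i hi g
  refine ⟨f, ?_⟩
  have h1 := LinearMap.congr_fun hf (Submodule.Quotient.mk 1)
  have h2 : i (Submodule.Quotient.mk 1) = a := one_smul R a
  have h3 : g (Submodule.Quotient.mk 1) = x₀ := one_smul R x₀
  rw [LinearMap.comp_apply, h2, h3] at h1
  rwa [h1]

theorem HSL.cogen' (hB : Module.Baer R E) (hx : x₀ ≠ 0)
    (hm : ∀ r ∈ IsLocalRing.maximalIdeal R, r • x₀ = 0)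
    {M : Type*} [AddCommGroup M] [Module R M] (B : Submodule R M) (a : M) (ha : a ∉ B) :
    ∃ f : M →ₗ[R] E, (∀ b ∈ B, f b = 0) ∧ f a ≠ 0 := by
  obtain ⟨f, hf⟩ := HSL.cogen hB hx hm (B.mkQ a)
    (fun h => ha ((Submodule.Quotient.mk_eq_zero B).1 h))
  refine ⟨f ∘ₗ B.mkQ, fun b hb => ?_, hf⟩
  rw [LinearMap.comp_apply, (Submodule.Quotient.mk_eq_zero B).2 hb |> (show B.mkQ b = 0 from ·),
    map_zero]

theorem HSL.length_simple (hx : x₀ ≠ 0)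
    (hm : ∀ r ∈ IsLocalRing.maximalIdeal R, r • x₀ = 0)
    (hess : ∀ x : E, x ≠ 0 → ∃ r : R, r • x = x₀)
    (M : Type*) [AddCommGroup M] [Module R M] [IsSimpleModule R M] :
    Module.length R (M →ₗ[R] E) ≤ 1 := by
  have hnt : Nontrivial M := IsSimpleModule.nontrivial R M
  obtain ⟨a, ha⟩ := exists_ne (0 : M)
  have hma : ∀ r ∈ IsLocalRing.maximalIdeal R, r • a = 0 := by
    have hmax : Ideal.IsMaximal (LinearMap.ker (LinearMap.toSpanSingleton R M a)) :=
      IsSimpleModule.ker_toSpanSingleton_isMaximal R ha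
    intro r hr
    have : r ∈ LinearMap.ker (LinearMap.toSpanSingleton R M a) := by
      rw [IsLocalRing.eq_maximalIdeal hmax]; exact hr
    simpa using this
  have hspan : Submodule.span R {a} = ⊤ := by
    rcases eq_bot_or_eq_top (Submodule.span R {a}) with h | h
    · exact absurd (Submodule.span_singleton_eq_bot.1 h) ha
    · exact h
  have hmem : ∀ f : M →ₗ[R] E, f a ∈ Submodule.span R {x₀} := by
    intro f
    by_cases hf : f a = 0
    · rw [hf]; exact Submodule.zero_mem _
    obtain ⟨r, hr⟩ := hess _ hf
    have hu : IsUnit r := by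
      by_contra h
      apply hx
      rw [← hr, ← map_smul, hma r ((IsLocalRing.mem_maximalIdeal r).2 h), map_zero]
    obtain ⟨u, rfl⟩ := hu
    refine Submodule.mem_span_singleton.2 ⟨((u⁻¹ : Rˣ) : R), ?_⟩
    rw [← hr, smul_smul]; simp
  let ev : (M →ₗ[R] E) →ₗ[R] Submodule.span R {x₀} :=
    LinearMap.codRestrict _ (LinearMap.applyₗ a) hmem
  have hev : Function.Injective ev := by
    rw [injective_iff_map_eq_zero]
    intro f hf
    have hfa : f a = 0 := congrArg Subtype.val hf
    ext y
    have : y ∈ Submodule.span R {a} := hspan ▸ Submodule.mem_top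
    obtain ⟨r, rfl⟩ := Submodule.mem_span_singleton.1 this
    simp [hfa]
  refine (Module.length_le_of_injective ev hev).trans ?_
  let g : (R ⧸ IsLocalRing.maximalIdeal R) →ₗ[R] Submodule.span R {x₀} :=
    Submodule.liftQ _ (LinearMap.toSpanSingleton R _ ⟨x₀, Submodule.mem_span_singleton_self x₀⟩)
      (fun r hr => by
        have := hm r hr
        simpa using this)
  have hg : Function.Surjective g := by
    rintro ⟨y, hy⟩
    obtain ⟨r, rfl⟩ := Submodule.mem_span_singleton.1 hy
    exact ⟨Submodule.Quotient.mk r, rfl⟩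
  refine (Module.length_le_of_surjective g hg).trans ?_
  have : IsSimpleModule R (R ⧸ IsLocalRing.maximalIdeal R) :=
    isSimpleModule_iff_isCoatom.2 (IsLocalRing.maximalIdeal.isMaximal R).out
  rw [Module.length_eq_one]

theorem HSL.length_hom (hx : x₀ ≠ 0)
    (hm : ∀ r ∈ IsLocalRing.maximalIdeal R, r • x₀ = 0)
    (hess : ∀ x : E, x ≠ 0 → ∃ r : R, r • x = x₀)
    (M : Type*) [AddCommGroup M] [Module R M] (hM : IsFiniteLength R M) :
    Module.length R (M →ₗ[R] E) ≤ Module.length R M := by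
  induction hM with
  | of_subsingleton => rw [Module.length_eq_zero]; exact zero_le
  | @of_simple_quotient M _ _ N _ _ ih =>
    let res : (M →ₗ[R] E) →ₗ[R] (N →ₗ[R] E) := LinearMap.lcomp R E N.subtype
    let q : ((M ⧸ N) →ₗ[R] E) →ₗ[R] (M →ₗ[R] E) := LinearMap.lcomp R E N.mkQ
    have hq : Function.Injective q := by
      intro f g h
      ext x
      exact LinearMap.congr_fun h x
    have hex : Function.Exact q res.rangeRestrict := by
      intro f
      constructor
      · intro h
        have h' : res f = 0 := congrArg Subtype.val h
        refine ⟨N.liftQ f (fun x hx => LinearMap.congr_fun h' ⟨x, hx⟩), ?_⟩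
        ext x; rfl
      · rintro ⟨g, rfl⟩
        apply Subtype.ext
        ext x
        change g (N.mkQ x) = 0
        rw [(show N.mkQ x = 0 from (Submodule.Quotient.mk_eq_zero N).2 x.2), map_zero]
    rw [Module.length_eq_add_of_exact q res.rangeRestrict hq res.surjective_rangeRestrict hex,
      Module.length_eq_add_of_exact N.subtype N.mkQ N.subtype_injective N.mkQ_surjective
        (LinearMap.exact_subtype_mkQ N), add_comm]
    refine add_le_add ?_ ?_
    · exact (Module.length_le_of_injective _ (Submodule.subtype_injective _)).trans ih
    · rw [Module.length_eq_one R (M ⧸ N)]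
      exact HSL.length_simple hx hm hess _

theorem HSL.finlen_pow (R : Type*) [CommRing R] [IsLocalRing R] [IsNoetherianRing R] (k : ℕ) :
    IsFiniteLength R (R ⧸ (IsLocalRing.maximalIdeal R) ^ (k + 1)) := by
  have : IsArtinianRing (R ⧸ (IsLocalRing.maximalIdeal R) ^ (k + 1)) := by
    apply IsLocalRing.quotient_artinian_of_mem_minimalPrimes_of_isLocalRing
    refine ⟨⟨inferInstance, Ideal.pow_le_self (by omega)⟩, ?_⟩
    rintro q ⟨hq, hle⟩ -
    exact hq.le_of_pow_le hle
  rw [isFiniteLength_iff_isNoetherian_isArtinian]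
  exact ⟨inferInstance, isArtinian_of_surjective_algebraMap
    (R := R ⧸ (IsLocalRing.maximalIdeal R) ^ (k + 1)) Ideal.Quotient.mk_surjective⟩

/-- Every endomorphism of `E` acts on the `m^(k+1)`-torsion as multiplication by a ring element. -/
theorem HSL.density [IsNoetherianRing R] (hB : Module.Baer R E) (hx : x₀ ≠ 0)
    (hm : ∀ r ∈ IsLocalRing.maximalIdeal R, r • x₀ = 0)
    (hess : ∀ x : E, x ≠ 0 → ∃ r : R, r • x = x₀) (k : ℕ) (φ : E →ₗ[R] E) :
    ∃ r : R, ∀ x : E, (∀ s ∈ IsLocalRing.maximalIdeal R ^ (k + 1), s • x = 0) → φ x = r • x := by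
  set I := IsLocalRing.maximalIdeal R ^ (k + 1) with hI
  let M : Submodule R E := Submodule.torsionBySet R E I
  have hMmem : ∀ x, x ∈ M ↔ ∀ s ∈ I, s • x = 0 := fun x => by
    simp [M, Submodule.mem_torsionBySet_iff]
  have hfl : IsFiniteLength R (R ⧸ I) := HSL.finlen_pow R k
  let j : M →ₗ[R] ((R ⧸ I) →ₗ[R] E) :=
    { toFun := fun x => Submodule.liftQ I (LinearMap.toSpanSingleton R E x.1)
        (fun s hs => by simpa using (hMmem x.1).1 x.2 s hs)
      map_add' := fun x y => by
        ext; exact smul_add (1 : R) x.1 y.1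
      map_smul' := fun r x => by
        ext; exact smul_comm (1 : R) r x.1 }
  have hj : Function.Injective j := by
    intro x y h
    have := LinearMap.congr_fun h (Submodule.Quotient.mk 1)
    apply Subtype.ext
    have h' : (1 : R) • x.1 = (1 : R) • y.1 := this
    simpa using h'
  have h1 : Module.length R M ≤ Module.length R (R ⧸ I) :=
    (Module.length_le_of_injective j hj).trans (HSL.length_hom hx hm hess _ hfl)
  have hflM : IsFiniteLength R M := by
    rw [← Module.length_ne_top_iff] at hfl ⊢
    exact ne_top_of_le_ne_top hfl h1
  have h2 : Module.length R (M →ₗ[R] E) ≤ Module.length R M := HSL.length_hom hx hm hess _ hflM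
  have hflH : IsFiniteLength R (M →ₗ[R] E) := by
    rw [← Module.length_ne_top_iff] at hflM ⊢
    exact ne_top_of_le_ne_top hflM h2
  let c : (R ⧸ I) →ₗ[R] (M →ₗ[R] E) :=
    Submodule.liftQ I (LinearMap.toSpanSingleton R _ M.subtype) (fun s hs => by
      rw [LinearMap.mem_ker]
      ext x
      simpa using (hMmem x.1).1 x.2 s hs)
  have hc : Function.Injective c := by
    rw [injective_iff_map_eq_zero]
    intro y hy
    obtain ⟨r, rfl⟩ := Submodule.Quotient.mk_surjective _ y
    by_contra hne
    obtain ⟨f, hf⟩ := HSL.cogen hB hx hm _ hne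
    apply hf
    have hmem : f (Submodule.Quotient.mk 1) ∈ M := by
      rw [hMmem]
      intro s hs
      rw [← map_smul, ← Submodule.Quotient.mk_smul,
        (Submodule.Quotient.mk_eq_zero I).2 (by simpa using hs), map_zero]
    have h5 := LinearMap.congr_fun hy ⟨_, hmem⟩
    have h6 : r • f (Submodule.Quotient.mk 1) = 0 := h5
    rw [← map_smul, ← Submodule.Quotient.mk_smul] at h6
    simpa using h6
  have hsurj : LinearMap.range c = ⊤ := by
    by_contra hne
    obtain ⟨hn, ha⟩ := isFiniteLength_iff_isNoetherian_isArtinian.1 hflH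
    have h7 := Submodule.length_lt hne
    rw [← (LinearEquiv.ofInjective c hc).length_eq] at h7
    exact absurd h7 (not_lt.2 (h2.trans h1))
  obtain ⟨y, hy⟩ := LinearMap.range_eq_top.1 hsurj (φ ∘ₗ M.subtype)
  obtain ⟨r, rfl⟩ := Submodule.Quotient.mk_surjective _ y
  refine ⟨r, fun x hx' => ?_⟩
  have := LinearMap.congr_fun hy ⟨x, (hMmem x).2 hx'⟩
  exact this.symm

end

/-- Elements of Artinian modules are torsion. -/
theorem HSL.torsion {R : Type*} [CommRing R] [IsLocalRing R] [IsNoetherianRing R]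
    {A : Type*} [AddCommGroup A] [Module R A] [IsArtinian R A] (a : A) :
    ∃ k : ℕ, ∀ l, k ≤ l → ∀ s ∈ IsLocalRing.maximalIdeal R ^ (l + 1), s • a = 0 := by
  set m := IsLocalRing.maximalIdeal R
  let N := Submodule.span R {a}
  obtain ⟨n, hn⟩ := IsArtinian.monotone_stabilizes (R := R) (M := A)
    ⟨fun k => OrderDual.toDual (m ^ k • N), fun i j hij =>
      Submodule.smul_mono_left (Ideal.pow_le_pow_right hij)⟩
  have h1 : m ^ n • N = m ^ (n + 1) • N := hn (n + 1) (by omega)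
  have h2 : m ^ n • N = ⊥ := by
    have hfg : (m ^ n • N).FG :=
      Submodule.FG.smul (IsNoetherian.noetherian _) (Submodule.fg_span_singleton a)
    refine Submodule.eq_bot_of_le_smul_of_le_jacobson_bot m _ hfg ?_
      (IsLocalRing.maximalIdeal_le_jacobson _)
    rw [← mul_smul, ← pow_succ', ← h1]
  refine ⟨n, fun l hl s hs => ?_⟩
  have h3 : s • a ∈ m ^ n • N :=
    Submodule.smul_mem_smul (Ideal.pow_le_pow_right (by omega) hs)
      (Submodule.mem_span_singleton_self a)
  rw [h2] at h3
  simpa using h3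


theorem HSL.noeth_of_faithful {T N : Type*} [CommRing T] [AddCommGroup N] [Module T N]
    [IsNoetherian T N] (h : ∀ t : T, (∀ x : N, t • x = 0) → t = 0) : IsNoetherianRing T := by
  obtain ⟨n, v, hv⟩ := Module.Finite.exists_fin (R := T) (M := N)
  let f : T →ₗ[T] (Fin n → N) := LinearMap.pi fun i => LinearMap.toSpanSingleton T N (v i)
  have hf : Function.Injective f := by
    rw [injective_iff_map_eq_zero]
    intro t ht
    apply h
    intro x
    have hx : x ∈ Submodule.span T (Set.range v) := hv ▸ Submodule.mem_top
    induction hx using Submodule.span_induction with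
    | mem x hx => obtain ⟨i, rfl⟩ := hx; exact congrFun ht i
    | zero => simp
    | add x y _ _ hx hy => rw [smul_add, hx, hy, add_zero]
    | smul a x _ hx => rw [smul_comm, hx, smul_zero]
  exact isNoetherian_of_injective f hf

theorem HSL.chain0 {T N : Type*} [CommRing T] [IsNoetherianRing T] [AddCommGroup N] [Module T N]
    [IsNoetherian T N] (c : ℕ → Submodule T N) (hc : Antitone c) (J : Ideal T)
    (hJ : ∀ n t, (∀ x ∈ c n, t • x ∈ c (n + 1)) → t ∈ J)
    (h2 : ∀ r ∈ J * J, ∀ x : N, r • x = 0) : J = ⊤ := by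
  by_contra hne
  obtain ⟨M, hM, hJM⟩ := Ideal.exists_le_maximal J hne
  obtain ⟨P, hP, -⟩ := Ideal.exists_minimalPrimes_le (I := J) (J := M) hJM
  have hPp : P.IsPrime := hP.1.1
  let S := Localization.AtPrime P
  let X := LocalizedModule P.primeCompl N
  let ℓ : N →ₗ[T] X := LocalizedModule.mkLinearMap P.primeCompl N
  let I : Ideal S := (J * J).map (algebraMap T S)
  have hcm : (IsLocalRing.maximalIdeal S).comap (algebraMap T S) = P :=
    Localization.AtPrime.under_maximalIdeal ..
  have hmin : IsLocalRing.maximalIdeal S ∈ I.minimalPrimes := by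
    refine ⟨⟨inferInstance, ?_⟩, ?_⟩
    · rw [Ideal.map_le_iff_le_comap, hcm]
      exact Ideal.mul_le_left.trans hP.1.2
    · rintro q ⟨hq, hIq⟩ hqm
      have h3 : J * J ≤ q.comap (algebraMap T S) := Ideal.map_le_iff_le_comap.1 hIq
      have hqp : (q.comap (algebraMap T S)).IsPrime := hq.comap _
      have h4 : J ≤ q.comap (algebraMap T S) := by
        rcases hqp.mul_le.1 h3 with h | h <;> exact h
      have h5 : q.comap (algebraMap T S) ≤ P :=
        (Ideal.comap_mono hqm).trans hcm.le
      have h6 : P ≤ q.comap (algebraMap T S) := hP.2 ⟨hqp, h4⟩ h5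
      rw [← Localization.AtPrime.map_eq_maximalIdeal]
      exact Ideal.map_le_iff_le_comap.2 h6
  have hSN : IsNoetherianRing S := IsLocalization.isNoetherianRing P.primeCompl S inferInstance
  have hArtR : IsArtinianRing (S ⧸ I) :=
    IsLocalRing.quotient_artinian_of_mem_minimalPrimes_of_isLocalRing I hmin
  have hfin : Module.Finite S X := Module.Finite.of_isLocalizedModule P.primeCompl ℓ
  have hArt : IsArtinian S X := by
    refine HSL.fl I X ?_
    have : I ≤ Module.annihilator S X := by
      rw [Ideal.map_le_iff_le_comap]
      intro r hr
      rw [Ideal.mem_comap, Module.mem_annihilator]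
      intro x
      induction x using LocalizedModule.induction_on with
      | _ n s =>
        rw [algebraMap_smul, LocalizedModule.smul'_mk, h2 r hr, LocalizedModule.zero_mk]
    exact fun s hs x => Module.mem_annihilator.1 (this hs) x
  obtain ⟨n, hn⟩ := IsArtinian.monotone_stabilizes (R := S) (M := X)
    ⟨fun k => OrderDual.toDual ((c k).localized' S P.primeCompl ℓ), fun i j hij => by
      change (c j).localized' S P.primeCompl ℓ ≤ (c i).localized' S P.primeCompl ℓ
      rintro x ⟨m, hm, s, rfl⟩
      exact ⟨m, hc hij hm, s, rfl⟩⟩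
  have h1 : (c n).localized' S P.primeCompl ℓ = (c (n + 1)).localized' S P.primeCompl ℓ :=
    hn (n + 1) (by omega)
  have hx : ∀ x ∈ c n, ∃ s : P.primeCompl, (s : T) • x ∈ c (n + 1) := by
    intro x hx
    have : ℓ x ∈ (c (n + 1)).localized' S P.primeCompl ℓ := by
      rw [← h1]
      exact ⟨x, hx, 1, by simp⟩
    obtain ⟨m, hm, s, hs⟩ := this
    have hs2 : ℓ m = ℓ ((s : T) • x) := by
      rw [map_smul]
      exact (IsLocalizedModule.mk'_eq_iff).1 hs
    rw [IsLocalizedModule.eq_iff_exists P.primeCompl] at hs2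
    replace hs := hs2
    obtain ⟨u, hu⟩ := hs
    refine ⟨u * s, ?_⟩
    have hu' : (u : T) • m = (u : T) • (s : T) • x := hu
    rw [Submonoid.coe_mul, mul_smul, ← hu']
    exact Submodule.smul_mem _ _ hm
  obtain ⟨G, hG⟩ := IsNoetherian.noetherian (c n)
  choose! s hs using hx
  have hall : ∀ x ∈ c n, (∏ g ∈ G, (s g : T)) • x ∈ c (n + 1) := by
    intro x hx
    rw [← hG] at hx
    induction hx using Submodule.span_induction with
    | mem x hxG =>
      have hxG' : x ∈ G := hxG
      classical
      rw [← Finset.prod_erase_mul _ _ hxG', mul_smul]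
      exact Submodule.smul_mem _ _ (hs x (hG ▸ Submodule.subset_span hxG))
    | zero => simp
    | add x y _ _ hx hy => rw [smul_add]; exact Submodule.add_mem _ hx hy
    | smul a x _ hx => rw [smul_comm]; exact Submodule.smul_mem _ _ hx
  have hmem : (∏ g ∈ G, (s g : T)) ∈ P.primeCompl := Submonoid.prod_mem _ fun g _ => (s g).2
  exact hmem (hP.1.2 (hJ n _ hall))

theorem HSL.chain1 {T N : Type*} [CommRing T] [IsNoetherianRing T] [AddCommGroup N] [Module T N]
    [IsNoetherian T N] (c : ℕ → Submodule T N) (hc : Antitone c) (J : Ideal T)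
    (hJ : ∀ n t, (∀ x ∈ c n, t • x ∈ c (n + 1)) → t ∈ J)
    (h2 : ∀ r ∈ J, ∀ s ∈ J, ∀ n, ∀ x ∈ c 0, (r * s) • x ∈ c n) : J = ⊤ := by
  let D : Submodule T (c 0) := (⨅ n, c n).comap (c 0).subtype
  refine HSL.chain0 (N := (c 0) ⧸ D) (fun n => ((c n).comap (c 0).subtype).map D.mkQ)
    (fun i j hij => Submodule.map_mono (Submodule.comap_mono (hc hij))) J ?_ ?_
  · intro n t ht
    refine hJ n t fun x hx => ?_
    have hx0 : x ∈ c 0 := hc (Nat.zero_le n) hx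
    obtain ⟨y, hy, hyx⟩ := ht (D.mkQ ⟨x, hx0⟩) ⟨⟨x, hx0⟩, hx, rfl⟩
    rw [← map_smul] at hyx
    have h3 : t • (⟨x, hx0⟩ : c 0) - y ∈ D := (Submodule.Quotient.eq D).1 hyx.symm
    have h4 : t • x - y ∈ c (n + 1) := (Submodule.mem_iInf _).1 h3 (n + 1)
    have := Submodule.add_mem _ h4 (show (y : N) ∈ c (n + 1) from hy)
    simpa using this
  · intro r hr x
    obtain ⟨x, rfl⟩ := D.mkQ_surjective x
    rw [← map_smul]
    refine (Submodule.Quotient.mk_eq_zero D).2 ?_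
    refine (Submodule.mem_iInf _).2 fun n => ?_
    change r • (x : N) ∈ c n
    induction hr using Submodule.mul_induction_on' with
    | mem_mul_mem a ha b hb => exact h2 a ha b hb n x x.2
    | add a _ b _ ha hb => rw [add_smul]; exact Submodule.add_mem _ ha hb

/-- The closure of `R` in the endomorphism ring of `A`. -/
def HSL.T (R A : Type*) [CommRing R] [AddCommGroup A] [Module R A] :
    Subring (Module.End R A) where
  carrier := {τ | ∀ a b : A, ∃ r : R, τ a = r • a ∧ τ b = r • b}
  mul_mem' := by
    intro τ σ hτ hσ a b
    obtain ⟨r, hr1, hr2⟩ := hτ a b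
    obtain ⟨s, hs1, hs2⟩ := hσ a b
    refine ⟨s * r, ?_, ?_⟩
    · rw [Module.End.mul_apply, hs1, map_smul, hr1, mul_smul]
    · rw [Module.End.mul_apply, hs2, map_smul, hr2, mul_smul]
  one_mem' := fun a b => ⟨1, by simp, by simp⟩
  add_mem' := by
    intro τ σ hτ hσ a b
    obtain ⟨r, hr1, hr2⟩ := hτ a b
    obtain ⟨s, hs1, hs2⟩ := hσ a b
    exact ⟨r + s, by simp [hr1, hs1, add_smul], by simp [hr2, hs2, add_smul]⟩
  zero_mem' := fun a b => ⟨0, by simp, by simp⟩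
  neg_mem' := by
    intro τ hτ a b
    obtain ⟨r, hr1, hr2⟩ := hτ a b
    exact ⟨-r, by simp [hr1], by simp [hr2]⟩

instance HSL.commRingT (R A : Type*) [CommRing R] [AddCommGroup A] [Module R A] :
    CommRing (HSL.T R A) :=
  { (inferInstance : Ring (HSL.T R A)) with
    mul_comm := by
      rintro ⟨τ, hτ⟩ ⟨σ, hσ⟩
      apply Subtype.ext
      ext a
      obtain ⟨r, hr, -⟩ := hτ a a
      obtain ⟨s, hs, -⟩ := hσ a a
      change τ (σ a) = σ (τ a)
      rw [hs, hr, map_smul, map_smul, hs, hr, smul_comm] }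

instance HSL.moduleT (R A E : Type*) [CommRing R] [AddCommGroup A] [Module R A]
    [AddCommGroup E] [Module R E] : Module (HSL.T R A) (A →ₗ[R] E) where
  smul t f := f ∘ₗ t.1
  one_smul f := by ext; rfl
  mul_smul s t f := by
    rw [mul_comm]
    ext; rfl
  smul_zero t := by ext; rfl
  smul_add t f g := by ext; rfl
  add_smul s t f := by
    ext a
    exact map_add f _ _
  zero_smul f := by
    ext a
    exact map_zero f

theorem HSL.smul_applyT {R A E : Type*} [CommRing R] [AddCommGroup A] [Module R A]
    [AddCommGroup E] [Module R E] (t : HSL.T R A) (f : A →ₗ[R] E) (a : A) :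
    (t • f) a = f (t.1 a) := rfl

/-- Endomorphisms of `E` are induced from `T`. -/
theorem HSL.lift {R A E : Type*} [CommRing R] [IsLocalRing R] [IsNoetherianRing R]
    [AddCommGroup A] [Module R A] [IsArtinian R A] [AddCommGroup E] [Module R E]
    {x₀ : E} (hB : Module.Baer R E) (hx : x₀ ≠ 0)
    (hm : ∀ r ∈ IsLocalRing.maximalIdeal R, r • x₀ = 0)
    (hess : ∀ x : E, x ≠ 0 → ∃ r : R, r • x = x₀) (φ : E →ₗ[R] E) :
    ∃ t : HSL.T R A, ∀ g : A →ₗ[R] E, t • g = φ ∘ₗ g := by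
  have key : ∀ a b : A, ∃ r : R, ∀ g : A →ₗ[R] E, φ (g a) = g (r • a) ∧ φ (g b) = g (r • b) := by
    intro a b
    obtain ⟨k, hk⟩ := HSL.torsion (R := R) a
    obtain ⟨l, hl⟩ := HSL.torsion (R := R) b
    obtain ⟨r, hr⟩ := HSL.density hB hx hm hess (max k l) φ
    refine ⟨r, fun g => ⟨?_, ?_⟩⟩
    · rw [map_smul]
      refine hr _ fun s hs => ?_
      rw [← map_smul, hk _ (le_max_left _ _) s hs, map_zero]
    · rw [map_smul]
      refine hr _ fun s hs => ?_
      rw [← map_smul, hl _ (le_max_right _ _) s hs, map_zero]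
  have huniq : ∀ a b : A, (∀ g : A →ₗ[R] E, g a = g b) → a = b := by
    intro a b h
    by_contra hne
    obtain ⟨f, hf⟩ := HSL.cogen hB hx hm (a - b) (sub_ne_zero.2 hne)
    exact hf (by rw [map_sub, h f, sub_self])
  have hex : ∀ a : A, ∃ b : A, ∀ g : A →ₗ[R] E, φ (g a) = g b := fun a => by
    obtain ⟨r, hr⟩ := key a a
    exact ⟨r • a, fun g => (hr g).1⟩
  choose τ hτ using hex
  let τ' : Module.End R A :=
    { toFun := τ
      map_add' := fun a b => huniq _ _ fun g => by
        rw [← hτ, map_add, map_add, map_add, hτ, hτ]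
      map_smul' := fun r a => huniq _ _ fun g => by
        rw [← hτ, map_smul, map_smul, hτ, RingHom.id_apply, map_smul] }
  refine ⟨⟨τ', fun a b => ?_⟩, fun g => ?_⟩
  · obtain ⟨r, hr⟩ := key a b
    exact ⟨r, huniq _ _ fun g => (hτ a g).symm.trans (hr g).1,
      huniq _ _ fun g => (hτ b g).symm.trans (hr g).2⟩
  · ext a
    exact (hτ a g).symm

theorem HSL.noethDual {R A E : Type*} [CommRing R] [IsLocalRing R] [IsNoetherianRing R]
    [AddCommGroup A] [Module R A] [IsArtinian R A] [AddCommGroup E] [Module R E]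
    {x₀ : E} (hB : Module.Baer R E) (hx : x₀ ≠ 0)
    (hm : ∀ r ∈ IsLocalRing.maximalIdeal R, r • x₀ = 0)
    (hess : ∀ x : E, x ≠ 0 → ∃ r : R, r • x = x₀) :
    IsNoetherian (HSL.T R A) (A →ₗ[R] E) := by
  classical
  let perp : Submodule (HSL.T R A) (A →ₗ[R] E) → Submodule R A := fun U =>
    ⨅ f ∈ U, LinearMap.ker f
  have hperp : ∀ U a, a ∈ perp U ↔ ∀ f ∈ U, f a = 0 := fun U a => by simp [perp]
  have closed : ∀ U (f : A →ₗ[R] E), (∀ a ∈ perp U, f a = 0) → f ∈ U := by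
    intro U f hf
    obtain ⟨B, ⟨s, hsB⟩, hmin⟩ := IsArtinian.set_has_minimal
      (Set.range fun s : Finset U => ⨅ g ∈ s, LinearMap.ker g.1) ⟨_, ∅, rfl⟩
    have hBp : ∀ a, (∀ g ∈ s, g.1 a = 0) → a ∈ perp U := by
      intro a ha
      rw [hperp]
      intro g hg
      have h1 := hmin _ ⟨insert ⟨g, hg⟩ s, rfl⟩
      have h2 : (⨅ g' ∈ insert (⟨g, hg⟩ : U) s, LinearMap.ker g'.1) ≤ B := by
        rw [← hsB]
        exact biInf_mono fun i hi => Finset.mem_insert_of_mem hi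
      have h3 := eq_of_le_of_not_lt h2 h1
      have h4 : a ∈ B := by rw [← hsB]; simpa using ha
      rw [← h3] at h4
      simp only [Submodule.mem_iInf] at h4
      exact h4 ⟨g, hg⟩ (Finset.mem_insert_self _ _)
    let G : A →ₗ[R] (s → E) := LinearMap.pi fun g => g.1.1
    have hGf : LinearMap.ker G ≤ LinearMap.ker f := by
      intro a ha
      refine hf a (hBp a fun g hg => ?_)
      exact congrFun ha ⟨g, hg⟩
    obtain ⟨h, hh⟩ := hB.extension_property ((LinearMap.ker G).liftQ G le_rfl)
      (LinearMap.ker_eq_bot.1 (Submodule.ker_liftQ_eq_bot _ _ _ le_rfl))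
      ((LinearMap.ker G).liftQ f hGf)
    have hfG : f = ∑ g : s, (h ∘ₗ LinearMap.single R (fun _ : s => E) g) ∘ₗ g.1.1 := by
      ext a
      have h1 : h (G a) = f a := LinearMap.congr_fun hh (Submodule.Quotient.mk a)
      rw [← h1, LinearMap.sum_apply]
      have h2 : G a = ∑ g : s, Pi.single g (g.1.1 a) := (Finset.univ_sum_single (G a)).symm
      rw [h2, map_sum]
      rfl
    rw [hfG]
    refine Submodule.sum_mem _ fun g _ => ?_
    obtain ⟨t, ht⟩ := HSL.lift (A := A) hB hx hm hess (h ∘ₗ LinearMap.single R (fun _ : s => E) g)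
    rw [← ht]
    exact U.smul_mem t g.1.2
  rw [isNoetherian_iff']
  have hanti : StrictAnti perp := by
    intro U V hUV
    refine lt_of_le_not_ge ?_ ?_
    · intro a ha
      rw [hperp] at ha ⊢
      exact fun f hf => ha f (hUV.le hf)
    · intro hle
      apply hUV.not_ge
      intro f hf
      exact closed U f fun a ha => (hperp V a).1 (hle ha) f hf
  exact hanti.wellFoundedGT


theorem HSL.main {R : Type*} [CommRing R] [IsLocalRing R] [IsNoetherianRing R]
    (p : ℕ) (hp : 2 ≤ p)
    (A : Type*) [AddCommGroup A] [Module R A] [IsArtinian R A]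
    (F : A → A) (hadd : ∀ a b : A, F (a + b) = F a + F b)
    (hsmul : ∀ (r : R) (a : A), F (r • a) = r ^ p • F a) :
    ∃ e : ℕ, ∀ n : ℕ, ∀ z : A, F^[n] z = 0 → F^[e] z = 0 := by
  have hF0 : F 0 = 0 := by simpa using hadd 0 0
  have hit0 : ∀ n, F^[n] 0 = 0 := fun n => Function.iterate_fixed hF0 n
  have hitadd : ∀ n a b, F^[n] (a + b) = F^[n] a + F^[n] b := by
    intro n
    induction n with
    | zero => simp
    | succ n ih => intro a b; rw [Function.iterate_succ_apply, hadd, ih]; rfl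
  have hitsmul : ∀ n (r : R) a, F^[n] (r • a) = r ^ p ^ n • F^[n] a := by
    intro n
    induction n with
    | zero => simp
    | succ n ih =>
      intro r a
      rw [Function.iterate_succ_apply, hsmul, ih, ← pow_mul, Function.iterate_succ_apply,
        pow_succ']
  let K : ℕ → Submodule R A := fun n =>
    { carrier := {z | F^[n] z = 0}
      add_mem' := fun {a b} ha hb => by
        change F^[n] (a + b) = 0
        rw [hitadd, show F^[n] a = 0 from ha, show F^[n] b = 0 from hb, add_zero]
      zero_mem' := hit0 n
      smul_mem' := fun r a ha => by
        change F^[n] (r • a) = 0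
        rw [hitsmul, show F^[n] a = 0 from ha, smul_zero] }
  have hKs : ∀ n z, z ∈ K (n + 1) ↔ F z ∈ K n := fun n z => Iff.rfl
  have hKmono : Monotone K := by
    refine monotone_nat_of_le_succ fun n z hz => ?_
    change F^[n + 1] z = 0
    rw [Function.iterate_succ_apply', show F^[n] z = 0 from hz, hF0]
  have hKT : ∀ n (t : HSL.T R A) z, z ∈ K n → t.1 z ∈ K n := by
    intro n t z hz
    obtain ⟨r, hr, -⟩ := t.2 z z
    rw [hr]
    exact (K n).smul_mem r hz
  obtain ⟨E, x₀, hB, hx, hm, hess⟩ := HSL.exists_hull R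
  have hN : IsNoetherian (HSL.T R A) (A →ₗ[R] E) := HSL.noethDual hB hx hm hess
  have hT : IsNoetherianRing (HSL.T R A) := by
    refine HSL.noeth_of_faithful (N := A →ₗ[R] E) fun t ht => ?_
    apply Subtype.ext
    refine LinearMap.ext fun a => ?_
    change t.1 a = 0
    by_contra hne
    obtain ⟨f, hf⟩ := HSL.cogen hB hx hm (t.1 a) hne
    exact hf (LinearMap.congr_fun (ht f) a)
  let J : ℕ → Ideal (HSL.T R A) := fun n =>
    { carrier := {t | ∀ z ∈ K (n + 1), t.1 z ∈ K n}
      add_mem' := fun {a b} ha hb z hz => (K n).add_mem (ha z hz) (hb z hz)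
      zero_mem' := fun z hz => (K n).zero_mem
      smul_mem' := fun r a ha z hz => hKT n r _ (ha z hz) }
  have hJm : Monotone J := by
    refine monotone_nat_of_le_succ fun n t ht z hz => ?_
    obtain ⟨r, hr, hr2⟩ := t.2 z (F z)
    have h1 : t.1 (F z) ∈ K n := ht (F z) hz
    rw [hKs, hr, hsmul, show p = (p - 1) + 1 by omega, pow_succ, mul_smul, ← hr2]
    exact (K n).smul_mem _ h1
  obtain ⟨n0, hn0⟩ := monotone_stabilizes_iff_noetherian.2 hT ⟨J, hJm⟩
  have hn0' : ∀ n, J (n0 + n) = J n0 := fun n => (hn0 (n0 + n) (by omega)).symm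
  have hJJ : ∀ m, ∀ t ∈ J n0, ∀ s ∈ J n0, ∀ z ∈ K (n0 + m), s.1 (t.1 z) ∈ K n0 := by
    intro m
    induction m with
    | zero => intro t _ s _ z hz; exact hKT _ _ _ (hKT _ _ _ hz)
    | succ m ih =>
      intro t ht s hs z hz
      apply hs
      obtain ⟨r, hr, hr2⟩ := t.2 z (F z)
      have h1 : t.1 (t.1 (F z)) ∈ K n0 := ih t ht t ht (F z) hz
      rw [hr2, map_smul, hr2, ← mul_smul] at h1
      rw [hKs, hr, hsmul, show p = (p - 2) + 2 by omega, pow_add, mul_smul, pow_two]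
      exact (K n0).smul_mem _ h1
  let c : ℕ → Submodule (HSL.T R A) (A →ₗ[R] E) := fun n =>
    { carrier := {f | ∀ a ∈ K (n0 + n), f a = 0}
      add_mem' := fun {f g} hf hg a ha => by
        rw [LinearMap.add_apply, hf a ha, hg a ha, add_zero]
      zero_mem' := fun a _ => rfl
      smul_mem' := fun t f hf a ha => hf _ (hKT _ t a ha) }
  have hc : Antitone c := fun i j hij f hf a ha => hf a (hKmono (by omega) ha)
  have htop : J n0 = ⊤ := by
    refine HSL.chain1 c hc (J n0) ?_ ?_
    · intro n t ht
      rw [← hn0' n]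
      intro z hz
      by_contra hne
      obtain ⟨f, hf, hfz⟩ := HSL.cogen' hB hx hm (K (n0 + n)) (t.1 z) hne
      exact hfz (ht f hf z hz)
    · intro r hr s hs n f hf a ha
      exact hf _ (hJJ n s hs r hr a ha)
  have hone : (1 : HSL.T R A) ∈ J n0 := htop ▸ Submodule.mem_top
  have hstep : ∀ n, K (n0 + n) ≤ K n0 := by
    intro n
    induction n with
    | zero => exact le_rfl
    | succ n ih =>
      intro z hz
      apply ih
      rw [← hn0' n] at hone
      exact hone z hz
  refine ⟨n0, fun n z hz => hstep n (hKmono (by omega : n ≤ n0 + n) hz)⟩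

theorem HSL_exists {R : Type*} [CommRing R] [IsLocalRing R] [IsNoetherianRing R]
    (p : ℕ) [Fact p.Prime] [CharP R p]
    (A : Type*) [AddCommGroup A] [Module R A] [IsArtinian R A]
    (F : A → A) (hadd : ∀ a b : A, F (a + b) = F a + F b)
    (hsmul : ∀ (r : R) (a : A), F (r • a) = r ^ p • F a) :
    ∃ e : ℕ, {z : A | ∃ n : ℕ, F^[n] z = 0} = {z : A | F^[e] z = 0} := by
  obtain ⟨e, he⟩ := HSL.main (R := R) p (Fact.out : p.Prime).two_le A F hadd hsmul
  refine ⟨e, Set.ext fun z => ⟨?_, fun h => ⟨e, h⟩⟩⟩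
  rintro ⟨n, hn⟩
  exact he n z hn
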